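/- arXiv:2601.19001 — 4 statements merged into one kernel-verified Lean document; each statement's English description precedes it below -/
import Mathlib

section
/- (Eq. (5), softmax is 1-Lipschitz from ℓ∞ to ℓ1) For every V ≥ 1 and all logit vectors ℓ, ℓ' : Fin V → ℝ, the standard softmax map sm(x) i = exp(x i) / ∑_j exp(x j) satisfies ∑_i |sm(ℓ') i − sm(ℓ) i| ≤ max_i |ℓ' i − ℓ i|; in particular, for a logit perturbation Δ, ‖sm(ℓ + Δ) − sm(ℓ)‖₁ ≤ ‖Δ‖_∞. -/
noncomputable def sm {V : ℕ} (x : Fin V → ℝ) (i : Fin V) : ℝ :=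
  Real.exp (x i) / ∑ j, Real.exp (x j)

lemma sm_nonneg {V : ℕ} (x : Fin V → ℝ) (i : Fin V) : 0 ≤ sm x i := by
  unfold sm; positivity

lemma sum_exp_pos {V : ℕ} [Nonempty (Fin V)] (x : Fin V → ℝ) : 0 < ∑ j, Real.exp (x j) :=
  Finset.sum_pos (fun _ _ => Real.exp_pos _) Finset.univ_nonempty

lemma sum_sm {V : ℕ} [Nonempty (Fin V)] (x : Fin V → ℝ) : ∑ i, sm x i = 1 := by
  simp only [sm, ← Finset.sum_div]
  exact div_self (sum_exp_pos x).ne'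

/-- The derivative of the softmax along a line is `p i * (d i - ∑ j, p j * d j)`. -/
lemma hasDerivAt_sm_line {V : ℕ} [Nonempty (Fin V)] (x d : Fin V → ℝ) (i : Fin V) (t : ℝ) :
    HasDerivAt (fun t : ℝ => sm (fun j => x j + t * d j) i)
      (sm (fun j => x j + t * d j) i * (d i - ∑ j, sm (fun j => x j + t * d j) j * d j)) t := by
  have hexp (j : Fin V) : HasDerivAt (fun t : ℝ => Real.exp (x j + t * d j))
      (Real.exp (x j + t * d j) * d j) t := by
    simpa using (((hasDerivAt_id t).mul_const (d j)).const_add (x j)).exp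
  have hZ := sum_exp_pos (fun j => x j + t * d j)
  have hsum : HasDerivAt (fun t : ℝ => ∑ j, Real.exp (x j + t * d j))
      (∑ j, Real.exp (x j + t * d j) * d j) t := HasDerivAt.fun_sum fun j _ => hexp j
  refine ((hexp i).fun_div hsum hZ.ne').congr_deriv ?_
  simp only [sm, div_mul_eq_mul_div, ← Finset.sum_div]
  field_simp

/-- The covariance of a sign vector with a vector bounded by `M` is at most `M`. -/
lemma abs_sum_sign_mul_centered_le {ι : Type*} [Fintype ι] {p s d : ι → ℝ} {M : ℝ}
    (hp : ∀ i, 0 ≤ p i) (hp1 : ∑ i, p i = 1) (hs : ∀ i, s i = 1 ∨ s i = -1)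
    (hM : 0 ≤ M) (hd : ∀ i, |d i| ≤ M) :
    |∑ i, s i * (p i * (d i - ∑ j, p j * d j))| ≤ M := by
  set m := ∑ i, p i * s i with hm
  have hs1 (i : ι) : |s i| ≤ 1 := by rcases hs i with h | h <;> simp [h]
  have hm1 : |m| ≤ 1 := by
    rw [← hp1]
    refine (Finset.abs_sum_le_sum_abs _ _).trans (Finset.sum_le_sum fun i _ => ?_)
    rw [abs_mul, abs_of_nonneg (hp i)]
    exact mul_le_of_le_one_right (hp i) (hs1 i)
  have hdev (i : ι) : |s i - m| = 1 - m * s i := by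
    obtain ⟨h₁, h₂⟩ := abs_le.mp hm1
    rcases hs i with h | h <;> rw [h]
    · rw [abs_of_nonneg] <;> linarith
    · rw [abs_of_nonpos] <;> linarith
  have hcov : ∑ i, s i * (p i * (d i - ∑ j, p j * d j)) = ∑ i, p i * d i * (s i - m) := by
    simp only [mul_sub, Finset.sum_sub_distrib, ← mul_assoc, ← Finset.sum_mul]
    rw [hm, mul_comm (∑ i, p i * d i)]
    congr 1
    · exact Finset.sum_congr rfl fun i _ => by ring
    · congr 1
      exact Finset.sum_congr rfl fun i _ => mul_comm _ _
  calc |∑ i, s i * (p i * (d i - ∑ j, p j * d j))|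
      ≤ ∑ i, |p i * d i * (s i - m)| := by
        rw [hcov]; exact Finset.abs_sum_le_sum_abs _ _
    _ ≤ ∑ i, M * (p i - m * (p i * s i)) := by
        refine Finset.sum_le_sum fun i _ => ?_
        rw [abs_mul, abs_mul, abs_of_nonneg (hp i), hdev]
        have h : 0 ≤ 1 - m * s i := hdev i ▸ abs_nonneg _
        calc p i * |d i| * (1 - m * s i) ≤ p i * M * (1 - m * s i) := by
              gcongr
              exacts [hp i, hd i]
          _ = M * (p i - m * (p i * s i)) := by ring
    _ = M * (1 - m * m) := by
        rw [← Finset.mul_sum, Finset.sum_sub_distrib, ← Finset.mul_sum, hp1]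
    _ ≤ M := mul_le_of_le_one_right hM (by linarith [mul_self_nonneg m])

/-- Eq. (5): the standard softmax is 1-Lipschitz from ℓ∞ to ℓ1. -/
theorem softmax_one_lipschitz_linf_l1 (V : ℕ) (hV : 1 ≤ V) (l l' : Fin V → ℝ) :
    ∑ i, |sm l' i - sm l i| ≤
      Finset.univ.sup' ⟨(⟨0, hV⟩ : Fin V), Finset.mem_univ _⟩ (fun i => |l' i - l i|) := by
  have : Nonempty (Fin V) := ⟨⟨0, hV⟩⟩
  set M := Finset.univ.sup' ⟨(⟨0, hV⟩ : Fin V), Finset.mem_univ _⟩ (fun i => |l' i - l i|)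
  have hd (i : Fin V) : |l' i - l i| ≤ M :=
    Finset.le_sup' (fun i => |l' i - l i|) (Finset.mem_univ i)
  have hM : 0 ≤ M := (abs_nonneg _).trans (hd ⟨0, hV⟩)
  let s (i : Fin V) : ℝ := if 0 ≤ sm l' i - sm l i then 1 else -1
  have hs (i : Fin V) : s i = 1 ∨ s i = -1 := by
    by_cases h : 0 ≤ sm l' i - sm l i <;> simp only [s, h, if_true, if_false, true_or, or_true]
  have habs (i : Fin V) : |sm l' i - sm l i| = s i * sm l' i - s i * sm l i := by
    by_cases h : 0 ≤ sm l' i - sm l i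
    · simp only [s, h, if_true, abs_of_nonneg, one_mul]
    · simp only [s, h, if_false, abs_of_neg (not_le.mp h)]
      ring
  have key := norm_image_sub_le_of_norm_deriv_le_segment_01'
    (f := fun t : ℝ => ∑ i, s i * sm (fun j => l j + t * (l' j - l j)) i) (C := M)
    (fun t _ => (HasDerivAt.fun_sum fun i _ =>
      (hasDerivAt_sm_line l (fun j => l' j - l j) i t).const_mul (s i)).hasDerivWithinAt)
    (fun t _ => abs_sum_sign_mul_centered_le (sm_nonneg _) (sum_sm _) hs hM hd)
  simp only [one_mul, zero_mul, add_zero, add_sub_cancel] at key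
  simp only [habs, Finset.sum_sub_distrib]
  exact (le_abs_self _).trans key
end

section
/- (Softmax₁ is 1-Lipschitz from ℓ∞ to ℓ1) For every m ≥ 1 and all x, y : Fin m → ℝ, ∑_i |Softmax₁(x) i − Softmax₁(y) i| ≤ max_i |x i − y i|. -/
noncomputable def softmax1 {m : ℕ} (x : Fin m → ℝ) (i : Fin m) : ℝ :=
  Real.exp (x i) / (1 + ∑ j, Real.exp (x j))

/-- The signed mass `(a - b) / (1 + a + b)` decreases by at most `d` when `a` is scaled by
`exp (-d)` and `b` by `exp d`. -/
theorem signed_mass_sub_scaled_le {a b d : ℝ} (ha : 0 ≤ a) (hb : 0 ≤ b) (hd : 0 ≤ d) :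
    (a - b) / (1 + a + b) - (a * Real.exp (-d) - b * Real.exp d) /
      (1 + a * Real.exp (-d) + b * Real.exp d) ≤ d := by
  have hmono : Monotone fun s : ℝ => s - (a * Real.exp s - b * Real.exp (-s)) /
      (1 + a * Real.exp s + b * Real.exp (-s)) := by
    have hderiv : ∀ s : ℝ, HasDerivAt (fun s : ℝ => s - (a * Real.exp s - b * Real.exp (-s)) /
        (1 + a * Real.exp s + b * Real.exp (-s)))
        (1 - ((a * Real.exp s + b * Real.exp (-s)) * (1 + a * Real.exp s + b * Real.exp (-s)) -
          (a * Real.exp s - b * Real.exp (-s)) * (a * Real.exp s - b * Real.exp (-s))) /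
          (1 + a * Real.exp s + b * Real.exp (-s)) ^ 2) s := by
      intro s
      have h₁ := (Real.hasDerivAt_exp s).const_mul a
      have h₂ := ((hasDerivAt_neg s).exp).const_mul b
      have hne : 1 + a * Real.exp s + b * Real.exp (-s) ≠ 0 := by positivity
      refine ((hasDerivAt_id s).sub ((h₁.sub h₂).div ((h₁.const_add 1).add h₂) hne)).congr_deriv ?_
      simp only [Pi.add_apply, Pi.sub_apply]
      ring
    refine monotone_of_deriv_nonneg (fun s => (hderiv s).differentiableAt) fun s => ?_
    rw [(hderiv s).deriv, sub_nonneg]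
    have hu : 0 ≤ a * Real.exp s := by positivity
    have hv : 0 ≤ b * Real.exp (-s) := by positivity
    refine div_le_one_of_le₀ ?_ (by positivity)
    nlinarith [sq_nonneg (a * Real.exp s - b * Real.exp (-s))]
  have h := hmono (neg_nonpos.mpr hd)
  simp only [neg_zero, neg_neg, Real.exp_zero, mul_one] at h
  linarith

theorem signed_mass_le_signed_mass {a b a' b' : ℝ} (ha : 0 ≤ a) (hb : 0 ≤ b) (haa : a ≤ a')
    (hbb : b' ≤ b) (hb' : 0 ≤ b') :
    (a - b) / (1 + a + b) ≤ (a' - b') / (1 + a' + b') := by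
  have ha' : 0 ≤ a' := ha.trans haa
  rw [div_le_div_iff₀ (by positivity) (by positivity)]
  nlinarith [mul_le_mul haa hbb hb' ha']

theorem sum_abs_softmax1_sub_le {m : ℕ} (x y : Fin m → ℝ) {d : ℝ} (hd : 0 ≤ d)
    (h : ∀ i, |x i - y i| ≤ d) : ∑ i, |softmax1 x i - softmax1 y i| ≤ d := by
  classical
  let A : Finset (Fin m) := {i | softmax1 y i ≤ softmax1 x i}
  have hsplit (f : Fin m → ℝ) : ∑ i ∈ A, f i + ∑ i ∈ Aᶜ, f i = ∑ i, f i :=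
    Finset.sum_add_sum_compl A f
  have hsigned (z : Fin m → ℝ) : ∑ i ∈ A, softmax1 z i - ∑ i ∈ Aᶜ, softmax1 z i =
      (∑ i ∈ A, Real.exp (z i) - ∑ i ∈ Aᶜ, Real.exp (z i)) /
        (1 + ∑ i ∈ A, Real.exp (z i) + ∑ i ∈ Aᶜ, Real.exp (z i)) := by
    simp only [softmax1]
    rw [← Finset.sum_div, ← Finset.sum_div, ← sub_div, add_assoc, hsplit]
  have hpos (z : Fin m → ℝ) (s : Finset (Fin m)) : 0 ≤ ∑ i ∈ s, Real.exp (z i) :=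
    Finset.sum_nonneg fun i _ => (Real.exp_pos _).le
  have hA : ∑ i ∈ A, |softmax1 x i - softmax1 y i| = ∑ i ∈ A, (softmax1 x i - softmax1 y i) :=
    Finset.sum_congr rfl fun i hi =>
      abs_of_nonneg (sub_nonneg.mpr (Finset.mem_filter.mp hi).2)
  have hAc : ∑ i ∈ Aᶜ, |softmax1 x i - softmax1 y i| =
      ∑ i ∈ Aᶜ, (softmax1 y i - softmax1 x i) := by
    refine Finset.sum_congr rfl fun i hi => ?_
    have hlt : softmax1 x i < softmax1 y i := by simpa [A] using hi
    rw [abs_of_neg (sub_neg.mpr hlt), neg_sub]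
  have ha : (∑ i ∈ A, Real.exp (x i)) * Real.exp (-d) ≤ ∑ i ∈ A, Real.exp (y i) := by
    rw [Finset.sum_mul]
    refine Finset.sum_le_sum fun i _ => ?_
    rw [← Real.exp_add, Real.exp_le_exp]
    linarith [(abs_le.mp (h i)).2]
  have hb : ∑ i ∈ Aᶜ, Real.exp (y i) ≤ (∑ i ∈ Aᶜ, Real.exp (x i)) * Real.exp d := by
    rw [Finset.sum_mul]
    refine Finset.sum_le_sum fun i _ => ?_
    rw [← Real.exp_add, Real.exp_le_exp]
    linarith [(abs_le.mp (h i)).1]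
  have hle := signed_mass_le_signed_mass (mul_nonneg (hpos x A) (Real.exp_pos _).le)
    (mul_nonneg (hpos x Aᶜ) (Real.exp_pos _).le) ha hb (hpos y Aᶜ)
  have hscaled := signed_mass_sub_scaled_le (hpos x A) (hpos x Aᶜ) hd
  rw [← hsigned y] at hle
  rw [← hsigned x] at hscaled
  rw [← hsplit, hA, hAc, Finset.sum_sub_distrib, Finset.sum_sub_distrib]
  linarith

/-- Softmax₁ is 1-Lipschitz from ℓ∞ to ℓ1. -/
theorem softmax1_one_lipschitz_linf_l1 (m : ℕ) (hm : 1 ≤ m) (x y : Fin m → ℝ) :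
    ∑ i, |softmax1 x i - softmax1 y i| ≤
      Finset.univ.sup' ⟨(⟨0, hm⟩ : Fin m), Finset.mem_univ _⟩ (fun i => |x i - y i|) := by
  have hle (i : Fin m) := Finset.le_sup' (fun i => |x i - y i|) (Finset.mem_univ i)
  exact sum_abs_softmax1_sub_le x y ((abs_nonneg _).trans (hle ⟨0, hm⟩)) hle
end

section
/- (Jacobian of Softmax₁ has ℓ∞→ℓ1 operator norm strictly less than 1) For every m ≥ 1, every x : Fin m → ℝ, and every s : Fin m → ℝ with |s j| ≤ 1 for all j, writing σ = Softmax₁(x), we have ∑_i |σ i * (s i − ∑_j σ j * s j)| ≤ ∑_j σ j < 1. -/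
/-- If a nonnegative weight has total mass at most `2`, then the weighted `ℓ¹` deviation of
`s ∈ [-1, 1]^ι` from its weighted sum is at most the total mass. -/
theorem sum_abs_mul_sub_sum_le_sum {ι : Type*} [Fintype ι] {w s : ι → ℝ} (hw : ∀ i, 0 ≤ w i)
    (hw2 : ∑ i, w i ≤ 2) (hs : ∀ i, |s i| ≤ 1) :
    ∑ i, |w i * (s i - ∑ j, w j * s j)| ≤ ∑ i, w i := by
  set c := ∑ j, w j * s j with hc
  have hpoint (i : ι) : |w i * (s i - c)| ≤ w i + w i * (c ^ 2 / 2) - w i * s i * c := by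
    have hsq : s i ^ 2 ≤ 1 := (sq_le_one_iff_abs_le_one _).2 (hs i)
    have hdev : |s i - c| ≤ 1 + c ^ 2 / 2 - s i * c := by
      nlinarith [sq_nonneg (|s i - c| - 1), sq_abs (s i - c)]
    rw [abs_mul, abs_of_nonneg (hw i)]
    nlinarith [mul_le_mul_of_nonneg_left hdev (hw i)]
  calc ∑ i, |w i * (s i - c)|
      ≤ ∑ i, (w i + w i * (c ^ 2 / 2) - w i * s i * c) := Finset.sum_le_sum fun i _ => hpoint i
    _ = ∑ i, w i + (∑ i, w i) * (c ^ 2 / 2) - c * c := by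
      rw [Finset.sum_sub_distrib, Finset.sum_add_distrib, ← Finset.sum_mul, ← Finset.sum_mul, ← hc]
    _ ≤ ∑ i, w i := by nlinarith [mul_le_mul_of_nonneg_right hw2 (sq_nonneg c)]

theorem softmax1_nonneg {m : ℕ} (x : Fin m → ℝ) (i : Fin m) : 0 ≤ softmax1 x i := by
  unfold softmax1
  positivity

theorem sum_softmax1_lt_one {m : ℕ} (x : Fin m → ℝ) : ∑ i, softmax1 x i < 1 := by
  unfold softmax1
  rw [← Finset.sum_div, div_lt_one (by positivity)]
  linarith

/-- The Jacobian of Softmax₁ has ℓ∞→ℓ1 operator norm strictly less than 1: for any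
direction `s` with `|s j| ≤ 1`, the ℓ1 norm of the Jacobian applied to `s` is at most
the total Softmax₁ mass, which is strictly less than 1. -/
theorem softmax1_jacobian_linf_l1_norm_lt_one (m : ℕ) (hm : 1 ≤ m) (x : Fin m → ℝ)
    (s : Fin m → ℝ) (hs : ∀ j, |s j| ≤ 1) :
    (∑ i, |softmax1 x i * (s i - ∑ j, softmax1 x j * s j)| ≤ ∑ j, softmax1 x j) ∧
    (∑ j, softmax1 x j) < 1 := by
  have hlt := sum_softmax1_lt_one x
  exact ⟨sum_abs_mul_sub_sum_le_sum (softmax1_nonneg x) (by linarith) hs, hlt⟩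
end

section
/- (Strict coordinatewise monotonicity of Softmax₁) For every m ≥ 1, every x : Fin m → ℝ, every index i, and every real t > 0: increasing the i-th score strictly increases the i-th weight, Softmax₁(x + t·e_i) i > Softmax₁(x) i, and strictly decreases every other weight, Softmax₁(x + t·e_i) j < Softmax₁(x) j for all j ≠ i, where x + t·e_i denotes x with its i-th coordinate increased by t. -/
/-- The normalizer of Softmax₁ after replacing one score, split into that score and the rest. -/
theorem sum_exp_update {m : ℕ} (x : Fin m → ℝ) (i : Fin m) (a : ℝ) :
    ∑ j, Real.exp (Function.update x i a j) =
      Real.exp a + ∑ j ∈ Finset.univ.erase i, Real.exp (x j) := by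
  rw [← Finset.add_sum_erase _ _ (Finset.mem_univ i), Function.update_self]
  congr 1
  refine Finset.sum_congr rfl fun j hj => ?_
  rw [Function.update_of_ne (Finset.ne_of_mem_erase hj)]

/-- Strict coordinatewise monotonicity of Softmax₁: increasing the `i`-th score by `t > 0`
strictly increases the `i`-th weight and strictly decreases every other weight. -/
theorem softmax1_strict_monotone (m : ℕ) (hm : 1 ≤ m) (x : Fin m → ℝ) (i : Fin m)
    (t : ℝ) (ht : 0 < t) :
    softmax1 (Function.update x i (x i + t)) i > softmax1 x i ∧
    ∀ j : Fin m, j ≠ i → softmax1 (Function.update x i (x i + t)) j < softmax1 x j := by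
  have hsum : ∑ j, Real.exp (x j) =
      Real.exp (x i) + ∑ j ∈ Finset.univ.erase i, Real.exp (x j) :=
    (Finset.add_sum_erase _ _ (Finset.mem_univ i)).symm
  have hS : 0 ≤ ∑ j ∈ Finset.univ.erase i, Real.exp (x j) :=
    Finset.sum_nonneg fun j _ => (Real.exp_pos _).le
  have hlt : Real.exp (x i) < Real.exp (x i + t) := Real.exp_lt_exp.2 (by linarith)
  have hpos : 0 < Real.exp (x i) := Real.exp_pos _
  refine ⟨?_, fun j hj => ?_⟩
  · simp only [softmax1, sum_exp_update, Function.update_self, hsum]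
    rw [gt_iff_lt, div_lt_div_iff₀ (by linarith) (by linarith)]
    nlinarith [mul_le_mul_of_nonneg_right hlt.le hS]
  · simp only [softmax1, sum_exp_update, Function.update_of_ne hj, hsum]
    exact div_lt_div_of_pos_left (Real.exp_pos _) (by linarith) (by linarith)
end
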